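/- Let V be a 3-dimensional real vector space and φ = φ₀ + φ₁ + φ₂ + φ₃ ∈ Λ(V*) with φ₀ ≠ 0 (a real number). Set A = (1/φ₀)·φ₁ ∈ V* and B = (1/φ₀)·φ₂ ∈ Λ²(V*). Then applying first the A-field action ψ = φ − A∧τφ and then the B-field action ψ − B∧ψ yields φ₀ + φ₃ − (1/φ₀)·φ₁∧φ₂; that is, the spin action of this (B+A)-field transforms φ into the spinor with degree-0 component φ₀, vanishing degree-1 and degree-2 components, and degree-3 component (1/φ₀)(φ₀φ₃ − φ₁∧φ₂) = (1/(2φ₀))⟨φ,φ⟩. -/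

import Mathlib

set_option synthInstance.maxHeartbeats 1000000
set_option maxHeartbeats 1000000

open Module ExteriorAlgebra

variable {V : Type*} [AddCommGroup V] [Module ℝ V]

/-- Projection onto the degree-`k` component of the exterior algebra `Λ(V*)`. -/
noncomputable def gproj (V : Type*) [AddCommGroup V] [Module ℝ V] (k : ℕ) :
    ExteriorAlgebra ℝ (Module.Dual ℝ V) →ₗ[ℝ] ExteriorAlgebra ℝ (Module.Dual ℝ V) :=
  GradedAlgebra.proj (fun i : ℕ => ⋀[ℝ]^i (Module.Dual ℝ V)) k

/-- The Chevalley pairing on `Λ(V*)` for a `3`-dimensional space `V`: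
`⟨φ,ψ⟩ = φ₀ψ₃ + ψ₀φ₃ − φ₁∧ψ₂ − ψ₁∧φ₂`. -/
noncomputable def chevPair (φ ψ : ExteriorAlgebra ℝ (Module.Dual ℝ V)) :
    ExteriorAlgebra ℝ (Module.Dual ℝ V) :=
  gproj V 0 φ * gproj V 3 ψ + gproj V 0 ψ * gproj V 3 φ
    - gproj V 1 φ * gproj V 2 ψ - gproj V 1 ψ * gproj V 2 φ

/-- The exterior powers of the dual above the dimension vanish. -/
theorem exteriorPower_dual_eq_bot [FiniteDimensional ℝ V] {k : ℕ} (hk : finrank ℝ V < k) :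
    ⋀[ℝ]^k (Module.Dual ℝ V) = ⊥ := by
  have h := exteriorPower.finrank_eq ℝ k (M := Module.Dual ℝ V)
  rw [Subspace.dual_finrank_eq, Nat.choose_eq_zero_of_lt hk] at h
  exact Submodule.finrank_eq_zero.mp h

theorem gproj_mem (k : ℕ) (φ : ExteriorAlgebra ℝ (Module.Dual ℝ V)) :
    gproj V k φ ∈ ⋀[ℝ]^k (Module.Dual ℝ V) :=
  SetLike.coe_mem _

theorem gproj_eq_zero [FiniteDimensional ℝ V] {k : ℕ} (hk : finrank ℝ V < k)
    (φ : ExteriorAlgebra ℝ (Module.Dual ℝ V)) : gproj V k φ = 0 := by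
  simpa [exteriorPower_dual_eq_bot hk] using gproj_mem k φ

theorem gproj_mul_gproj_eq_zero [FiniteDimensional ℝ V] {j k : ℕ} (hjk : finrank ℝ V < j + k)
    (φ ψ : ExteriorAlgebra ℝ (Module.Dual ℝ V)) : gproj V j φ * gproj V k ψ = 0 := by
  have h : gproj V j φ * gproj V k ψ ∈ ⋀[ℝ]^(j + k) (Module.Dual ℝ V) :=
    SetLike.mul_mem_graded (gproj_mem j φ) (gproj_mem k ψ)
  rwa [exteriorPower_dual_eq_bot hjk, Submodule.mem_bot] at h

/-- A spinor is the sum of its components of degree at most the dimension. -/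
theorem sum_gproj [FiniteDimensional ℝ V] (φ : ExteriorAlgebra ℝ (Module.Dual ℝ V)) :
    ∑ k ∈ Finset.range (finrank ℝ V + 1), gproj V k φ = φ := by
  classical
  conv_rhs => rw [← DirectSum.sum_support_decompose (fun i : ℕ => ⋀[ℝ]^i (Module.Dual ℝ V)) φ]
  symm
  refine Finset.sum_subset (fun k hk => ?_) fun k _ hk => ?_
  · by_contra h
    rw [Finset.mem_range, not_lt] at h
    exact (GradedAlgebra.mem_support_iff _ φ k).mp hk (gproj_eq_zero h φ)
  · exact not_not.mp fun h => hk ((GradedAlgebra.mem_support_iff _ φ k).mpr h)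

theorem gproj_one_mul_self (φ : ExteriorAlgebra ℝ (Module.Dual ℝ V)) :
    gproj V 1 φ * gproj V 1 φ = 0 := by
  obtain ⟨v, hv⟩ : gproj V 1 φ ∈ LinearMap.range (ι ℝ) := by
    simpa only [pow_one] using gproj_mem 1 φ
  rw [← hv, ι_sq_zero]

/-- The grade involution acts on the degree-`k` part by the sign `(-1)^k`. -/
theorem involute_of_mem_exteriorPower {k : ℕ} {x : ExteriorAlgebra ℝ (Module.Dual ℝ V)}
    (hx : x ∈ ⋀[ℝ]^k (Module.Dual ℝ V)) :
    CliffordAlgebra.involute x = (-1 : ℝ) ^ k • x := by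
  rw [← ιMulti_span_fixedDegree] at hx
  induction hx using Submodule.span_induction with
  | mem x hx =>
    obtain ⟨v, rfl⟩ := hx
    have h := CliffordAlgebra.involute_prod_map_ι (Q := (0 : QuadraticForm ℝ (Module.Dual ℝ V)))
      (List.ofFn v)
    rw [List.map_ofFn, List.length_ofFn] at h
    rw [ιMulti_apply]
    exact h
  | zero => simp
  | add x y _ _ hx hy => rw [map_add, hx, hy, smul_add]
  | smul a x _ hx => rw [map_smul, hx, smul_comm]

theorem involute_gproj (k : ℕ) (φ : ExteriorAlgebra ℝ (Module.Dual ℝ V)) :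
    CliffordAlgebra.involute (gproj V k φ) = (-1 : ℝ) ^ k • gproj V k φ :=
  involute_of_mem_exteriorPower (gproj_mem k φ)

/-- On a `3`-dimensional space, given a spinor `φ = φ₀ + φ₁ + φ₂ + φ₃` with `φ₀ = c ≠ 0`,
applying the `A`-field action with `A = φ₁/φ₀` and then the `B`-field action with
`B = φ₂/φ₀` transforms `φ` into `φ₀ + φ₃ − (1/φ₀)·φ₁∧φ₂`, the spinor with vanishing
degree-`1` and degree-`2` components and degree-`3` component
`(1/φ₀)(φ₀φ₃ − φ₁∧φ₂) = (1/(2φ₀))⟨φ,φ⟩`. -/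
theorem spin_action_normal_form [FiniteDimensional ℝ V] (h3 : Module.finrank ℝ V = 3)
    (φ : ExteriorAlgebra ℝ (Module.Dual ℝ V)) (c : ℝ) (hc : c ≠ 0)
    (h0 : gproj V 0 φ = algebraMap ℝ (ExteriorAlgebra ℝ (Module.Dual ℝ V)) c) :
    (φ - (c⁻¹ • gproj V 1 φ) * CliffordAlgebra.involute φ)
        - (c⁻¹ • gproj V 2 φ) *
          (φ - (c⁻¹ • gproj V 1 φ) * CliffordAlgebra.involute φ)
      = algebraMap ℝ (ExteriorAlgebra ℝ (Module.Dual ℝ V)) c + gproj V 3 φ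
          - c⁻¹ • (gproj V 1 φ * gproj V 2 φ) ∧
    (φ - (c⁻¹ • gproj V 1 φ) * CliffordAlgebra.involute φ)
        - (c⁻¹ • gproj V 2 φ) *
          (φ - (c⁻¹ • gproj V 1 φ) * CliffordAlgebra.involute φ)
      = algebraMap ℝ (ExteriorAlgebra ℝ (Module.Dual ℝ V)) c
          + (2 * c)⁻¹ • chevPair φ φ := by
  have hφ : algebraMap ℝ (ExteriorAlgebra ℝ (Module.Dual ℝ V)) c
      + gproj V 1 φ + gproj V 2 φ + gproj V 3 φ = φ := by
    simpa [h3, Finset.sum_range_succ, h0] using sum_gproj φ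
  have hτ : CliffordAlgebra.involute φ =
      algebraMap ℝ (ExteriorAlgebra ℝ (Module.Dual ℝ V)) c - gproj V 1 φ
        + gproj V 2 φ - gproj V 3 φ := by
    conv_lhs => rw [← hφ, ← h0]
    rw [map_add, map_add, map_add, involute_gproj, involute_gproj, involute_gproj,
      involute_gproj, h0]
    module
  have h11 := gproj_one_mul_self φ
  have h13 : gproj V 1 φ * gproj V 3 φ = 0 := gproj_mul_gproj_eq_zero (by lia) φ φ
  have h22 : gproj V 2 φ * gproj V 2 φ = 0 := gproj_mul_gproj_eq_zero (by lia) φ φ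
  have h23 : gproj V 2 φ * gproj V 3 φ = 0 := gproj_mul_gproj_eq_zero (by lia) φ φ
  have h212 : gproj V 2 φ * (gproj V 1 φ * gproj V 2 φ) = 0 := by
    have h : gproj V 2 φ * (gproj V 1 φ * gproj V 2 φ) ∈ ⋀[ℝ]^(2 + (1 + 2)) (Module.Dual ℝ V) :=
      SetLike.mul_mem_graded (gproj_mem 2 φ)
        (SetLike.mul_mem_graded (gproj_mem 1 φ) (gproj_mem 2 φ))
    rwa [exteriorPower_dual_eq_bot (by lia), Submodule.mem_bot] at h
  have hA : φ - (c⁻¹ • gproj V 1 φ) * CliffordAlgebra.involute φ =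
      algebraMap ℝ (ExteriorAlgebra ℝ (Module.Dual ℝ V)) c + gproj V 2 φ + gproj V 3 φ
        - c⁻¹ • (gproj V 1 φ * gproj V 2 φ) := by
    rw [hτ]
    conv_lhs => enter [1]; rw [← hφ]
    simp only [mul_add, mul_sub, smul_mul_assoc, h11, h13, ← Algebra.commutes c,
      ← Algebra.smul_def, smul_zero]
    match_scalars <;> field_simp
    norm_num
  have hB : (φ - (c⁻¹ • gproj V 1 φ) * CliffordAlgebra.involute φ)
        - (c⁻¹ • gproj V 2 φ) * (φ - (c⁻¹ • gproj V 1 φ) * CliffordAlgebra.involute φ)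
      = algebraMap ℝ (ExteriorAlgebra ℝ (Module.Dual ℝ V)) c + gproj V 3 φ
          - c⁻¹ • (gproj V 1 φ * gproj V 2 φ) := by
    rw [hA]
    simp only [mul_add, mul_sub, smul_mul_assoc, mul_smul_comm, h22, h23, h212,
      ← Algebra.commutes c, ← Algebra.smul_def, smul_zero]
    match_scalars <;> field_simp
    norm_num
  refine ⟨hB, hB.trans ?_⟩
  rw [chevPair, h0, ← Algebra.smul_def]
  match_scalars <;> field_simp <;> norm_num
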